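/- Let d_x, n ∈ ℕ, γ ∈ (0,1], K_H > 0, ε > 0, K ∈ ℕ and δ ∈ (0, 1/(3K)]. Let f belong to the Hölder class H^γ([0,1]^{d_x×n}, K_H), and let g: ℝ^{d_x×n} → ℝ satisfy |g(X) − f(X)| ≤ ε for every X ∈ [0,1]^{d_x×n} outside the trifling region Ω([0,1]^{d_x×n}, K, δ). Enumerate the standard basis matrices of ℝ^{d_x×n} as E^{(1)}, …, E^{(d_x n)} (E^{(u+(v−1)d_x)} has a 1 in position (u,v) and 0 elsewhere). Define Φ^{(0)} = g and, for k = 1, …, d_x n, Φ^{(k)}(X) = mid(Φ^{(k−1)}(X − δ E^{(k)}), Φ^{(k−1)}(X), Φ^{(k−1)}(X + δ E^{(k)})), where mid(a,b,c) is the middle value (median) of a, b, c. Then |Φ^{(d_x n)}(X) − f(X)| ≤ ε + d_x n K_H δ^γ for every X ∈ [0,1]^{d_x×n}. -/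

import Mathlib

open MeasureTheory Matrix

noncomputable section

/-- The column-wise softmax `σ_S`. -/
noncomputable def softmaxCol {d n : ℕ} (A : Matrix (Fin d) (Fin n) ℝ) :
    Matrix (Fin d) (Fin n) ℝ :=
  Matrix.of fun i j => Real.exp (A i j) / ∑ k, Real.exp (A k j)

/-- The entrywise ReLU `σ_R`. -/
def reluM {d n : ℕ} (A : Matrix (Fin d) (Fin n) ℝ) : Matrix (Fin d) (Fin n) ℝ :=
  Matrix.of fun i j => max (A i j) 0

/-- A self-attention layer with `H` heads of head size `S` on `ℝ^{D×n}`. -/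
def IsSelfAttn (n D H S : ℕ)
    (f : Matrix (Fin D) (Fin n) ℝ → Matrix (Fin D) (Fin n) ℝ) : Prop :=
  ∃ (WV WK WQ : Fin H → Matrix (Fin S) (Fin D) ℝ)
    (WO : Fin H → Matrix (Fin D) (Fin S) ℝ),
    ∀ Z, f Z = Z + ∑ h, WO h * ((WV h * Z) * softmaxCol ((WK h * Z)ᵀ * (WQ h * Z)))

/-- A feed-forward layer with hidden dimension `W` on `ℝ^{D×n}`. -/
def IsFeedForward (n D W : ℕ)
    (f : Matrix (Fin D) (Fin n) ℝ → Matrix (Fin D) (Fin n) ℝ) : Prop :=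
  ∃ (W1 : Matrix (Fin W) (Fin D) ℝ) (W2 : Matrix (Fin D) (Fin W) ℝ)
    (b1 : Fin W → ℝ) (b2 : Fin D → ℝ),
    ∀ Z, f Z = Z + W2 * reluM (W1 * Z + Matrix.of fun i _ => b1 i) +
      Matrix.of fun i _ => b2 i

/-- Membership in the transformer class `T_{dx,dy}(D,H,S,W,L)` with sequence length `n`. -/
def IsTransformer (n dx dy D H S W L : ℕ)
    (f : Matrix (Fin dx) (Fin n) ℝ → Matrix (Fin dy) (Fin n) ℝ) : Prop :=
  ∃ (Ain : Matrix (Fin D) (Fin dx) ℝ) (P : Matrix (Fin D) (Fin n) ℝ)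
    (Aout : Matrix (Fin dy) (Fin D) ℝ)
    (SA FF : Fin L → Matrix (Fin D) (Fin n) ℝ → Matrix (Fin D) (Fin n) ℝ),
    (∀ l, IsSelfAttn n D H S (SA l)) ∧ (∀ l, IsFeedForward n D W (FF l)) ∧
    ∀ X, f X = Aout * Fin.foldl L (fun Z l => FF l (SA l Z)) (Ain * X + P)

/-- The Frobenius norm of a real matrix. -/
noncomputable def frobNorm {d n : ℕ} (A : Matrix (Fin d) (Fin n) ℝ) : ℝ :=
  Real.sqrt (∑ i, ∑ j, (A i j) ^ 2)

/-- The unit cube `[0,1]^{d×n}` of matrices. -/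
def unitCube (d n : ℕ) : Set (Matrix (Fin d) (Fin n) ℝ) :=
  {X | ∀ i j, X i j ∈ Set.Icc (0 : ℝ) 1}

/-- The Hölder class `H^γ(Ω, K)`: the sum of the sup-norm and the `γ`-Hölder seminorm
(w.r.t. the Frobenius norm) is at most `K`. -/
def HolderClass {d n : ℕ} (γ K : ℝ) (Ω : Set (Matrix (Fin d) (Fin n) ℝ))
    (f : Matrix (Fin d) (Fin n) ℝ → ℝ) : Prop :=
  ∃ C1 C2 : ℝ, 0 ≤ C1 ∧ 0 ≤ C2 ∧ C1 + C2 ≤ K ∧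
    (∀ X ∈ Ω, |f X| ≤ C1) ∧
    ∀ X ∈ Ω, ∀ Y ∈ Ω, |f X - f Y| ≤ C2 * frobNorm (X - Y) ^ γ

noncomputable instance matrixMeasureSpace {d n : ℕ} :
    MeasureSpace (Matrix (Fin d) (Fin n) ℝ) :=
  inferInstanceAs (MeasureSpace (Fin d → Fin n → ℝ))

/-- The `L^p` norm over the unit cube of a matrix-valued map, measured in Frobenius norm. -/
noncomputable def lpNormCube {d n : ℕ} (p : ℝ)
    (G : Matrix (Fin d) (Fin n) ℝ → Matrix (Fin d) (Fin n) ℝ) : ℝ :=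
  (∫ X in unitCube d n, frobNorm (G X) ^ p) ^ (1 / p)

end

/-- The trifling region `Ω([0,1]^{d×n}, K, δ)`. -/
def trifling (d n K : ℕ) (δ : ℝ) : Set (Matrix (Fin d) (Fin n) ℝ) :=
  {X ∈ unitCube d n | ∃ i j, ∃ t ∈ Finset.Icc 1 (K - 1),
    X i j ∈ Set.Ioo ((t : ℝ) / K) ((t : ℝ) / K + δ)}

/-- The middle value (median) of three reals. -/
noncomputable def mid3 (a b c : ℝ) : ℝ := a + b + c - max a (max b c) - min a (min b c)

/-- The `k`-th standard basis matrix (`k = 0,…,dxn−1`, column-major): a `1` in position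
`(u, v)` with `k = u + v·dx`, zeros elsewhere. -/
def basisE (dx n : ℕ) (k : ℕ) : Matrix (Fin dx) (Fin n) ℝ :=
  Matrix.of fun i j => if (i : ℕ) + (j : ℕ) * dx = k then 1 else 0

/-- The iterated mid-construction `Φ^{(k)}` of the horizontal-shift argument:
`Φ^{(0)} = g` and
`Φ^{(k+1)}(X) = mid(Φ^{(k)}(X − δE^{(k+1)}), Φ^{(k)}(X), Φ^{(k)}(X + δE^{(k+1)}))`. -/
noncomputable def midIter {dx n : ℕ} (δ : ℝ) (g : Matrix (Fin dx) (Fin n) ℝ → ℝ) :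
    ℕ → Matrix (Fin dx) (Fin n) ℝ → ℝ
  | 0 => g
  | k + 1 => fun X =>
      mid3 (midIter δ g k (X - δ • basisE dx n k)) (midIter δ g k X)
        (midIter δ g k (X + δ • basisE dx n k))


/-- A coordinate value in the unit interval outside the bad intervals. -/
def goodPt (K : ℕ) (δ : ℝ) (y : ℝ) : Prop :=
  ∀ t : ℕ, 1 ≤ t → t ≤ K - 1 → ¬ ((t : ℝ) / K < y ∧ y < (t : ℝ) / K + δ)

theorem bad_pair {K : ℕ} (hK : 0 < K) {δ : ℝ} (hδ : 0 < δ) (h3 : 3 * δ ≤ 1 / K) {x y : ℝ}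
    (hxy : δ ≤ y - x) (hxy2 : y - x ≤ 2 * δ) : goodPt K δ x ∨ goodPt K δ y := by
  by_contra hc
  simp only [goodPt] at hc
  push Not at hc
  obtain ⟨⟨t, _, _, ht1, ht2⟩, ⟨s, _, _, hs1, hs2⟩⟩ := hc
  have hK' : (0 : ℝ) < K := by exact_mod_cast hK
  rcases lt_trichotomy t s with h | h | h
  · have : (t : ℝ) + 1 ≤ s := by exact_mod_cast h
    have h2 : (t : ℝ) / K + 1 / K ≤ s / K := by rw [← add_div]; gcongr
    linarith
  · subst h; linarith
  · have : (s : ℝ) + 1 ≤ t := by exact_mod_cast h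
    have h2 : (s : ℝ) / K + 1 / K ≤ t / K := by rw [← add_div]; gcongr
    linarith

theorem good_low {K : ℕ} (hK : 0 < K) {δ : ℝ} (h3 : 3 * δ ≤ 1 / K) (hδ : 0 < δ) {x : ℝ}
    (hx : x ≤ 2 * δ) : goodPt K δ x := by
  rintro t h1 h2 ⟨h4, h5⟩
  have hK' : (0 : ℝ) < K := by exact_mod_cast hK
  have : (1 : ℝ) ≤ t := by exact_mod_cast h1
  have h6 : 1 / (K : ℝ) ≤ t / K := by gcongr
  linarith

theorem good_high {K : ℕ} (hK : 0 < K) {δ : ℝ} (h3 : 3 * δ ≤ 1 / K) {x : ℝ}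
    (hx : 1 - 2 * δ ≤ x) : goodPt K δ x := by
  rintro t h1 h2 ⟨h4, h5⟩
  have hK' : (0 : ℝ) < K := by exact_mod_cast hK
  have h7 : (t : ℝ) + 1 ≤ K := by
    have : t + 1 ≤ K := by omega
    exact_mod_cast this
  have h6 : (t : ℝ) / K + 1 / K ≤ 1 := by
    rw [← add_div]; exact (div_le_one hK').2 h7
  linarith

/-- Two of the three shifted points are good and inside the unit interval. -/
theorem two_good {K : ℕ} (hK : 0 < K) {δ : ℝ} (hδ : 0 < δ) (h3 : 3 * δ ≤ 1 / K) {x : ℝ}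
    (hx : x ∈ Set.Icc (0 : ℝ) 1) (G : ℝ → Prop)
    (hG : ∀ y, G y ↔ y ∈ Set.Icc (0 : ℝ) 1 ∧ goodPt K δ y) :
    (G (x - δ) ∧ G x) ∨ (G (x - δ) ∧ G (x + δ)) ∨ (G x ∧ G (x + δ)) := by
  obtain ⟨h0, h1⟩ := hx
  have hK1 : 1 / (K : ℝ) ≤ 1 := by
    have : (1 : ℝ) ≤ K := by exact_mod_cast hK
    exact (div_le_one (by linarith)).2 this
  simp only [hG, Set.mem_Icc]
  by_cases ha : x < δ
  · right; right
    exact ⟨⟨⟨h0, h1⟩, good_low hK h3 hδ (by linarith)⟩, ⟨by linarith, by linarith⟩,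
      good_low hK h3 hδ (by linarith)⟩
  by_cases hb : 1 - δ < x
  · left
    exact ⟨⟨⟨by linarith, by linarith⟩, good_high hK h3 (by linarith)⟩, ⟨h0, h1⟩,
      good_high hK h3 (by linarith)⟩
  push Not at ha hb
  have e1 : 0 ≤ x - δ ∧ x - δ ≤ 1 := ⟨by linarith, by linarith⟩
  have e2 : 0 ≤ x ∧ x ≤ 1 := ⟨h0, h1⟩
  have e3 : 0 ≤ x + δ ∧ x + δ ≤ 1 := ⟨by linarith, by linarith⟩
  have p1 := bad_pair hK hδ h3 (x := x - δ) (y := x) (by linarith) (by linarith)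
  have p2 := bad_pair hK hδ h3 (x := x - δ) (y := x + δ) (by linarith) (by linarith)
  have p3 := bad_pair hK hδ h3 (x := x) (y := x + δ) (by linarith) (by linarith)
  tauto

theorem mid3_close {a b c m r : ℝ}
    (h : (|a - m| ≤ r ∧ |b - m| ≤ r) ∨ (|a - m| ≤ r ∧ |c - m| ≤ r) ∨
      (|b - m| ≤ r ∧ |c - m| ≤ r)) : |mid3 a b c - m| ≤ r := by
  simp only [abs_le, mid3] at *
  rcases le_total a b with h1 | h1 <;> rcases le_total b c with h2 | h2 <;>
    rcases le_total a c with h3 | h3 <;>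
    simp only [max_def, min_def] <;> split_ifs <;>
    rcases h with ⟨⟨_, _⟩, _, _⟩ | ⟨⟨_, _⟩, _, _⟩ | ⟨⟨_, _⟩, _, _⟩ <;>
    constructor <;> linarith

theorem index_inj {dx n : ℕ} {i i' : Fin dx} {j j' : Fin n}
    (h : (i : ℕ) + (j : ℕ) * dx = i' + j' * dx) : i = i' ∧ j = j' := by
  have hd : 0 < dx := i.pos
  have h1 := congrArg (· % dx) h
  have h2 := congrArg (· / dx) h
  simp only [Nat.add_mul_mod_self_right, Nat.mod_eq_of_lt i.2, Nat.mod_eq_of_lt i'.2] at h1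
  simp only [Nat.add_mul_div_right _ _ hd, Nat.div_eq_of_lt i.2, Nat.div_eq_of_lt i'.2,
    zero_add] at h2
  exact ⟨Fin.ext h1, Fin.ext h2⟩

theorem frob_basis {dx n : ℕ} (i0 : Fin dx) (j0 : Fin n) (c : ℝ) :
    frobNorm (c • basisE dx n (i0 + j0 * dx)) = |c| := by
  have hE : ∀ i j, (c • basisE dx n (i0 + j0 * dx)) i j = if i = i0 then
      (if j = j0 then c else 0) else 0 := by
    intro i j
    simp only [basisE, Matrix.smul_apply, Matrix.of_apply, smul_eq_mul]
    by_cases h : (i : ℕ) + (j : ℕ) * dx = i0 + j0 * dx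
    · obtain ⟨rfl, rfl⟩ := index_inj h
      simp
    · rw [if_neg h]
      by_cases hi : i = i0
      · by_cases hj : j = j0
        · subst hi hj; exact absurd rfl h
        · simp [hj]
      · simp [hi]
  unfold frobNorm
  rw [Finset.sum_eq_single i0, Finset.sum_eq_single j0]
  · rw [hE]; simp [Real.sqrt_sq_eq_abs]
  · intro j _ hj; rw [hE]; simp [hj]
  · simp
  · intro i _ hi
    apply Finset.sum_eq_zero
    intro j _
    rw [hE]; simp [hi]
  · simp

theorem midIter_step {dx n K : ℕ} {γ KH ε δ : ℝ} (hKH : 0 < KH)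
    (hK : 0 < K) (hδ : 0 < δ) (h3 : 3 * δ ≤ 1 / K)
    (f : Matrix (Fin dx) (Fin n) ℝ → ℝ) (hf : HolderClass γ KH (unitCube dx n) f)
    (g : Matrix (Fin dx) (Fin n) ℝ → ℝ)
    (hg : ∀ X ∈ unitCube dx n \ trifling dx n K δ, |g X - f X| ≤ ε) (k : ℕ) (hk : k ≤ dx * n) :
    ∀ X ∈ unitCube dx n,
      (∀ (i : Fin dx) (j : Fin n), k ≤ (i : ℕ) + (j : ℕ) * dx → goodPt K δ (X i j)) →
      |midIter δ g k X - f X| ≤ ε + k * KH * δ ^ γ := by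
  induction k with
  | zero =>
    intro X hX hgood
    simp only [midIter, Nat.cast_zero, zero_mul, add_zero]
    refine hg X ⟨hX, ?_⟩
    rintro ⟨_, i, j, t, ht, h1, h2⟩
    rw [Finset.mem_Icc] at ht
    exact hgood i j (Nat.zero_le _) t ht.1 ht.2 ⟨h1, h2⟩
  | succ k ih =>
    intro X hX hgood
    have ih := ih (by omega)
    have hdx : 0 < dx := by
      rcases Nat.eq_zero_or_pos dx with h | h
      · subst h; simp at hk
      · exact h
    obtain ⟨i0, j0, hij⟩ : ∃ (i0 : Fin dx) (j0 : Fin n), k = (i0 : ℕ) + (j0 : ℕ) * dx :=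
      ⟨⟨k % dx, Nat.mod_lt _ hdx⟩, ⟨k / dx, Nat.div_lt_of_lt_mul (by omega)⟩,
        by simp only []; rw [mul_comm]; exact (Nat.mod_add_div k dx).symm⟩
    have hpow : 0 ≤ KH * δ ^ γ := by positivity
    have key : ∀ c : ℝ, (c = 0 ∨ |c| = δ) →
        (X i0 j0 + c ∈ Set.Icc (0 : ℝ) 1 ∧ goodPt K δ (X i0 j0 + c)) →
        |midIter δ g k (X + c • basisE dx n k) - f X| ≤ ε + (k + 1 : ℕ) * KH * δ ^ γ := by
      intro c hc hgc
      have ent : ∀ i j, (X + c • basisE dx n k) i j =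
          if (i : ℕ) + (j : ℕ) * dx = k then X i0 j0 + c else X i j := by
        intro i j
        simp only [basisE, Matrix.add_apply, Matrix.smul_apply, Matrix.of_apply, smul_eq_mul]
        split_ifs with h
        · obtain ⟨rfl, rfl⟩ := index_inj (h.trans hij)
          simp
        · simp
      have hY : X + c • basisE dx n k ∈ unitCube dx n := by
        intro i j
        rw [ent]
        split_ifs
        · exact hgc.1
        · exact hX i j
      have h1 := ih _ hY (by
        intro i j h
        rw [ent]
        split_ifs with h'
        · exact hgc.2
        · exact hgood i j (by omega))
      have h2 : |f (X + c • basisE dx n k) - f X| ≤ KH * δ ^ γ := by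
        rcases hc with rfl | hc
        · simpa using hpow
        · obtain ⟨C1, C2, hC1, hC2, hC, _, hH⟩ := hf
          refine (hH _ hY _ hX).trans ?_
          rw [add_sub_cancel_left, hij, frob_basis, hc]
          gcongr
          linarith
      have h4 := abs_sub_le (midIter δ g k (X + c • basisE dx n k))
        (f (X + c • basisE dx n k)) (f X)
      push_cast
      linarith
    have tg := two_good hK hδ h3 (hX i0 j0) _ (fun y => Iff.rfl)
    have ka := key (-δ) (Or.inr (by rw [abs_neg, abs_of_pos hδ]))
    have kb := key 0 (Or.inl rfl)
    have kc := key δ (Or.inr (abs_of_pos hδ))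
    rw [neg_smul, ← sub_eq_add_neg, ← sub_eq_add_neg] at ka
    rw [zero_smul, add_zero, add_zero] at kb
    apply mid3_close
    rcases tg with ⟨h, h'⟩ | ⟨h, h'⟩ | ⟨h, h'⟩
    · exact Or.inl ⟨ka h, kb h'⟩
    · exact Or.inr (Or.inl ⟨ka h, kc h'⟩)
    · exact Or.inr (Or.inr ⟨kb h, kc h'⟩)

/-- Step 1 of Proposition 3, after Lemma 3.3 of Lu et al.: the iterated
mid-construction upgrades approximation outside the trifling region to approximation on the
whole cube, at the cost of an extra `dxn·K_H·δ^γ`. -/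
theorem midIter_approx
    (dx n : ℕ) (hdx : 0 < dx) (hn : 0 < n) (γ KH ε : ℝ)
    (hγ : γ ∈ Set.Ioc (0 : ℝ) 1) (hKH : 0 < KH) (hε : 0 < ε)
    (K : ℕ) (hK : 0 < K) (δ : ℝ) (hδ : δ ∈ Set.Ioc (0 : ℝ) (1 / (3 * K)))
    (f : Matrix (Fin dx) (Fin n) ℝ → ℝ) (hf : HolderClass γ KH (unitCube dx n) f)
    (g : Matrix (Fin dx) (Fin n) ℝ → ℝ)
    (hg : ∀ X ∈ unitCube dx n \ trifling dx n K δ, |g X - f X| ≤ ε) :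
    ∀ X ∈ unitCube dx n,
      |midIter δ g (dx * n) X - f X| ≤ ε + (dx : ℝ) * n * KH * δ ^ γ := by
  intro X hX
  have hK' : (0 : ℝ) < K := by exact_mod_cast hK
  have h3 : 3 * δ ≤ 1 / K := by
    have h := hδ.2
    have e : (1 : ℝ) / K = 3 * (1 / (3 * K)) := by field_simp
    rw [e]; linarith
  have h := midIter_step hKH hK hδ.1 h3 f hf g hg (dx * n) le_rfl X hX (by
    intro i j hij
    exfalso
    have h1 := i.2
    have h2 : ((j : ℕ) + 1) * dx ≤ n * dx := Nat.mul_le_mul_right _ j.2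
    rw [add_mul, mul_comm n dx] at h2
    omega)
  push_cast at h
  exact h
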